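/- arXiv:2402.00545 — 2 statements merged into one kernel-verified Lean document; each statement's English description precedes it below -/
import Mathlib

section
/- Let Λ be an A-lattice of rank r in L, and for N ∈ ℚ set ε(Λ_N) := ∏_{0≠λ∈Λ, log λ ≤ N} sgn(λ) (a finite product). Then there exist N₀ ∈ ℚ and a root of unity ε^Λ ∈ L^× such that for every rational N ≥ N₀ and every integer d ≥ 1: ε(Λ_N)^{q^{rd}} · ε(Λ_{N+d})^{−1} = (ε^Λ)^{(q^{rd}−1)/(q^r−1)}; in particular ε^Λ = ε(Λ_N)^{q^r} · ε(Λ_{N+1})^{−1} is independent of N ≥ N₀ and is an invariant of Λ. Moreover ε^{cΛ} = ε^Λ for every nonzero c ∈ K. -/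
open scoped Classical

noncomputable section

variable {Fq : Type*} [Field Fq] [Fintype Fq]
variable {L : Type*} [NormedField L] [CompleteSpace L]
variable [Algebra (Polynomial Fq) L]

/-- `log_q |z|`. -/
def logq (q : ℕ) (z : L) : ℝ := Real.logb q ‖z‖

/-- An `A = 𝔽_q[T]`-lattice of rank `r` in `L`: a finitely generated `A`-submodule which is
free of rank `r` (equivalently: its `𝔽_q(T)`-span has dimension `r`), and which is
discrete in `L` (finite intersection with every bounded ball). -/
def IsLatticeOfRank (r : ℕ) (Λ : Submodule (Polynomial Fq) L) : Prop :=
  (∃ b : Fin r → L, LinearIndependent (Polynomial Fq) b ∧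
      Submodule.span (Polynomial Fq) (Set.range b) = Λ) ∧
  ∀ B : ℝ, {x : L | x ∈ Λ ∧ ‖x‖ ≤ B}.Finite

/-- Membership in `K·Λ`, the `K = 𝔽_q(T)`-span of `Λ` in `L`. -/
def InKSpan (Λ : Submodule (Polynomial Fq) L) (u : L) : Prop :=
  ∃ n : Polynomial Fq, n ≠ 0 ∧ n • u ∈ Λ

/-- The exponential function of the lattice `Λ`: `e^Λ(z) = z·∏_{0≠λ∈Λ} (1 - z/λ)`. -/
def latExp (Λ : Submodule (Polynomial Fq) L) (z : L) : L :=
  z * ∏' l : {x : L // x ∈ Λ ∧ x ≠ 0}, (1 - z / (l : L))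

/-- The scaled lattice `c·Λ`. -/
def scaleSub (c : L) (Λ : Submodule (Polynomial Fq) L) : Submodule (Polynomial Fq) L :=
  Submodule.map (LinearMap.mulLeft (Polynomial Fq) c) Λ

/-- The set of nonzero `λ ∈ u + Λ` with `log λ ≤ N` (a finite set for a lattice `Λ`). -/
def ballSet (q : ℕ) (Λ : Submodule (Polynomial Fq) L) (u : L) (N : ℚ) : Set L :=
  {l : L | l ≠ 0 ∧ l - u ∈ Λ ∧ logq q l ≤ (N : ℝ)}

/-- The rational number `s` with `|z| = q^s` (whenever it exists; `0` otherwise). -/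
def rlog (q : ℕ) (z : L) : ℚ :=
  if h : ∃ s : ℚ, ‖z‖ = (q : ℝ) ^ (s : ℝ) then h.choose else 0

/-- The `1`-unit part `⟨z⟩ = z·ρ(log z)·sgn(z)⁻¹` of `z ∈ L^×`, relative to a compatible
system `ρ` of rational powers of the uniformizer `π = T⁻¹` and a sign function `sgn`. -/
def uPart (q : ℕ) (ρ : ℚ → L) (sgn : L → L) (z : L) : L :=
  z * ρ (rlog q z) * (sgn z)⁻¹

/-- `ε((u+Λ)_N) = ∏_{0≠λ∈u+Λ, log λ ≤ N} sgn λ` (a finite product for a lattice). -/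
def sgnProd (q : ℕ) (sgn : L → L) (Λ : Submodule (Polynomial Fq) L) (u : L) (N : ℚ) : L :=
  ∏ᶠ l ∈ ballSet q Λ u N, sgn l

/-- In characteristic `p`, the only root of unity in the open unit ball around `1` is `1`. -/
theorem eq_one_of_pow_eq_one_of_norm_sub_one_lt {F : Type*} [NormedField F] (p : ℕ)
    [Fact p.Prime] [CharP F p] {ζ : F} {k : ℕ} (hk : 0 < k) (hζ : ζ ^ k = 1)
    (h : ‖ζ - 1‖ < 1) : ζ = 1 := by
  by_contra hne
  have hp : 1 < p := (Fact.out : p.Prime).one_lt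
  have hpos : 0 < ‖ζ - 1‖ := norm_pos_iff.2 (sub_ne_zero.2 hne)
  have hinj : Function.Injective fun n : ℕ => ζ ^ p ^ n := by
    intro m n hmn
    have hsub : (ζ - 1) ^ p ^ m = (ζ - 1) ^ p ^ n := by
      simpa [sub_pow_char_pow] using hmn
    have hnorm : ‖ζ - 1‖ ^ p ^ m = ‖ζ - 1‖ ^ p ^ n := by
      rw [← norm_pow, ← norm_pow, hsub]
    exact Nat.pow_right_injective hp (pow_right_injective₀ hpos h.ne hnorm)
  refine Set.infinite_range_of_injective hinj
    (((Finset.range k).image fun i => ζ ^ i).finite_toSet.subset ?_)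
  rintro _ ⟨n, rfl⟩
  simp only [Finset.coe_image, Set.mem_image, Finset.coe_range, Set.mem_Iio]
  exact ⟨p ^ n % k, Nat.mod_lt _ hk, (pow_eq_pow_mod _ hζ).symm⟩

theorem norm_eq_one_of_pow_eq_one {F : Type*} [NormedField F] {ζ : F} {k : ℕ}
    (hζ : ζ ^ k = 1) (hk : k ≠ 0) : ‖ζ‖ = 1 :=
  (pow_eq_one_iff_of_nonneg (norm_nonneg _) hk).1 (by rw [← norm_pow, hζ, norm_one])

/-- The standing hypotheses on the valued field `L`, the rational powers `ρ` of the
uniformizer and the sign function `sgn`. -/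
structure IsSignSystem (Fq : Type*) [Field Fq] [Fintype Fq] {L : Type*} [NormedField L]
    [Algebra (Polynomial Fq) L] (q : ℕ) (ρ : ℚ → L) (sgn : L → L) : Prop where
  card_eq : Fintype.card Fq = q
  norm_add_le_max : ∀ x y : L, ‖x + y‖ ≤ max ‖x‖ ‖y‖
  norm_algebraMap : ∀ a : Polynomial Fq, a ≠ 0 →
    ‖algebraMap (Polynomial Fq) L a‖ = (q : ℝ) ^ a.natDegree
  exists_norm_eq : ∀ x : L, x ≠ 0 → ∃ s : ℚ, ‖x‖ = (q : ℝ) ^ (s : ℝ)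
  rho_add : ∀ x y : ℚ, ρ (x + y) = ρ x * ρ y
  rho_one : ρ 1 * algebraMap (Polynomial Fq) L Polynomial.X = 1
  sgn_spec : ∀ z : L, z ≠ 0 →
    (∃ k : ℕ, 0 < k ∧ sgn z ^ k = 1) ∧ ‖uPart q ρ sgn z - 1‖ < 1

namespace IsSignSystem

variable {F : Type*} [Field F] [Fintype F] {E : Type*} [NormedField E]
  [Algebra (Polynomial F) E] {q : ℕ} {ρ : ℚ → E} {sgn : E → E}

theorem one_lt (h : IsSignSystem F q ρ sgn) : (1 : ℝ) < q := by
  rw [← h.card_eq]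
  exact_mod_cast Fintype.one_lt_card

theorem norm_sub_lt (h : IsSignSystem F q ρ sgn) {x y : E} {B : ℝ} (hx : ‖x‖ < B)
    (hy : ‖y‖ < B) : ‖x - y‖ < B := by
  rw [sub_eq_add_neg]
  exact (h.norm_add_le_max _ _).trans_lt (max_lt hx (by rwa [norm_neg]))

theorem norm_add_eq (h : IsSignSystem F q ρ sgn) {x y : E} (hxy : ‖y‖ < ‖x‖) :
    ‖x + y‖ = ‖x‖ := by
  refine le_antisymm ((h.norm_add_le_max _ _).trans_eq (max_eq_left hxy.le)) ?_
  by_contra! hlt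
  simpa using h.norm_sub_lt hlt hxy

theorem norm_eq_rpow_rlog (h : IsSignSystem F q ρ sgn) {z : E} (hz : z ≠ 0) :
    ‖z‖ = (q : ℝ) ^ (rlog q z : ℝ) := by
  have hex := h.exists_norm_eq z hz
  rw [rlog, dif_pos hex]
  exact hex.choose_spec

theorem rlog_eq (h : IsSignSystem F q ρ sgn) {z : E} (hz : z ≠ 0) {s : ℚ}
    (hs : ‖z‖ = (q : ℝ) ^ (s : ℝ)) : rlog q z = s := by
  rw [h.norm_eq_rpow_rlog hz] at hs
  exact_mod_cast Real.strictMono_rpow_of_base_gt_one h.one_lt |>.injective hs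

theorem rlog_mul (h : IsSignSystem F q ρ sgn) {x y : E} (hx : x ≠ 0) (hy : y ≠ 0) :
    rlog q (x * y) = rlog q x + rlog q y := by
  refine h.rlog_eq (mul_ne_zero hx hy) ?_
  rw [norm_mul, h.norm_eq_rpow_rlog hx, h.norm_eq_rpow_rlog hy, Rat.cast_add,
    Real.rpow_add (zero_lt_one.trans h.one_lt)]

theorem sgn_ne_zero (h : IsSignSystem F q ρ sgn) {z : E} (hz : z ≠ 0) : sgn z ≠ 0 := by
  obtain ⟨⟨k, hk, hk1⟩, -⟩ := h.sgn_spec z hz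
  intro h0
  simp [h0, hk.ne'] at hk1

theorem norm_sgn (h : IsSignSystem F q ρ sgn) {z : E} (hz : z ≠ 0) : ‖sgn z‖ = 1 := by
  obtain ⟨⟨k, hk, hk1⟩, -⟩ := h.sgn_spec z hz
  exact norm_eq_one_of_pow_eq_one hk1 hk.ne'

theorem norm_mul_rho_sub_sgn_lt (h : IsSignSystem F q ρ sgn) {z : E} (hz : z ≠ 0) :
    ‖z * ρ (rlog q z) - sgn z‖ < 1 := by
  have hu := (h.sgn_spec z hz).2
  have heq : z * ρ (rlog q z) - sgn z = (uPart q ρ sgn z - 1) * sgn z := by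
    have := h.sgn_ne_zero hz
    rw [uPart]
    field_simp
  rwa [heq, norm_mul, h.norm_sgn hz, mul_one]

theorem norm_mul_rho (h : IsSignSystem F q ρ sgn) {z : E} (hz : z ≠ 0) :
    ‖z * ρ (rlog q z)‖ = 1 := by
  have hlt := h.norm_mul_rho_sub_sgn_lt hz
  rw [← h.norm_sgn hz] at hlt
  simpa [h.norm_sgn hz] using h.norm_add_eq hlt

theorem eq_sgn (h : IsSignSystem F q ρ sgn) {z s : E} (hz : z ≠ 0)
    (hs : ∃ k : ℕ, 0 < k ∧ s ^ k = 1) (hlt : ‖z * ρ (rlog q z) - s‖ < 1) : sgn z = s := by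
  obtain ⟨p, hp⟩ := CharP.exists F
  have : Fact p.Prime := ⟨CharP.char_is_prime F p⟩
  have : CharP E p := charP_of_injective_ringHom
    ((algebraMap (Polynomial F) E).comp Polynomial.C).injective p
  obtain ⟨k, hk, hsk⟩ := hs
  obtain ⟨⟨l, hl, htl⟩, -⟩ := h.sgn_spec z hz
  have hs0 : s ≠ 0 := by
    rintro rfl
    simp [hk.ne'] at hsk
  have hs1 : ‖s‖ = 1 := norm_eq_one_of_pow_eq_one hsk hk.ne'
  have hdiv : sgn z / s = 1 := by
    refine eq_one_of_pow_eq_one_of_norm_sub_one_lt p (Nat.mul_pos hl hk) ?_ ?_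
    · rw [div_pow, pow_mul, htl, mul_comm, pow_mul, hsk, one_pow, one_pow, div_one]
    · rw [div_sub_one hs0, norm_div, hs1, div_one]
      simpa using h.norm_sub_lt hlt (h.norm_mul_rho_sub_sgn_lt hz)
  exact (div_eq_one_iff_eq hs0).1 hdiv

theorem sgn_mul (h : IsSignSystem F q ρ sgn) {x y : E} (hx : x ≠ 0) (hy : y ≠ 0) :
    sgn (x * y) = sgn x * sgn y := by
  obtain ⟨⟨k, hk, hsk⟩, -⟩ := h.sgn_spec x hx
  obtain ⟨⟨l, hl, htl⟩, -⟩ := h.sgn_spec y hy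
  refine h.eq_sgn (mul_ne_zero hx hy) ⟨k * l, Nat.mul_pos hk hl, ?_⟩ ?_
  · rw [mul_pow, pow_mul, hsk, mul_comm k, pow_mul, htl, one_pow, one_pow, one_mul]
  · rw [h.rlog_mul hx hy, h.rho_add]
    have heq : x * y * (ρ (rlog q x) * ρ (rlog q y)) - sgn x * sgn y =
        (x * ρ (rlog q x) - sgn x) * (y * ρ (rlog q y)) +
          sgn x * (y * ρ (rlog q y) - sgn y) := by ring
    rw [heq]
    refine (h.norm_add_le_max _ _).trans_lt (max_lt ?_ ?_)
    · rw [norm_mul, h.norm_mul_rho hy, mul_one]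
      exact h.norm_mul_rho_sub_sgn_lt hx
    · rw [norm_mul, h.norm_sgn hx, one_mul]
      exact h.norm_mul_rho_sub_sgn_lt hy

theorem sgn_add_of_norm_lt (h : IsSignSystem F q ρ sgn) {x y : E} (hxy : ‖y‖ < ‖x‖) :
    sgn (x + y) = sgn x := by
  have hx : x ≠ 0 := norm_pos_iff.1 ((norm_nonneg y).trans_lt hxy)
  have hn := h.norm_add_eq hxy
  have hxy0 : x + y ≠ 0 := norm_pos_iff.1 (hn ▸ norm_pos_iff.2 hx)
  refine h.eq_sgn hxy0 (h.sgn_spec x hx).1 ?_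
  rw [h.rlog_eq hxy0 (hn.trans (h.norm_eq_rpow_rlog hx))]
  have heq : (x + y) * ρ (rlog q x) - sgn x =
      (x * ρ (rlog q x) - sgn x) + y * ρ (rlog q x) := by ring
  rw [heq]
  refine (h.norm_add_le_max _ _).trans_lt (max_lt (h.norm_mul_rho_sub_sgn_lt hx) ?_)
  have hone := h.norm_mul_rho hx
  rw [norm_mul] at hone ⊢
  rw [← hone]
  refine mul_lt_mul_of_pos_right hxy ((norm_nonneg _).lt_of_ne fun h0 => ?_)
  simp [← h0] at hone

theorem algebraMap_ne_zero (h : IsSignSystem F q ρ sgn) {a : Polynomial F} (ha : a ≠ 0) :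
    algebraMap (Polynomial F) E a ≠ 0 := by
  rw [← norm_pos_iff, h.norm_algebraMap a ha]
  exact pow_pos (zero_lt_one.trans h.one_lt) _

theorem norm_X (h : IsSignSystem F q ρ sgn) :
    ‖algebraMap (Polynomial F) E Polynomial.X‖ = q := by
  simpa using h.norm_algebraMap Polynomial.X Polynomial.X_ne_zero

theorem sgn_X (h : IsSignSystem F q ρ sgn) :
    sgn (algebraMap (Polynomial F) E Polynomial.X) = 1 := by
  have hX := h.algebraMap_ne_zero (Polynomial.X_ne_zero (R := F))
  refine h.eq_sgn hX ⟨1, one_pos, one_pow 1⟩ ?_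
  rw [h.rlog_eq hX (s := 1) (by simp [h.norm_X]), mul_comm, h.rho_one]
  simp

theorem sgn_C (h : IsSignSystem F q ρ sgn) {c : F} (hc : c ≠ 0) :
    sgn (algebraMap (Polynomial F) E (Polynomial.C c)) =
      algebraMap (Polynomial F) E (Polynomial.C c) := by
  have hC := h.algebraMap_ne_zero (Polynomial.C_ne_zero.2 hc)
  have hρ0 : ρ 0 = 1 := by
    have h1 : ρ 1 ≠ 0 := left_ne_zero_of_mul_eq_one h.rho_one
    have h2 := h.rho_add 0 1
    rw [zero_add] at h2
    exact (mul_eq_right₀ h1).1 h2.symm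
  refine h.eq_sgn hC ⟨Fintype.card F - 1, Nat.sub_pos_of_lt Fintype.one_lt_card, ?_⟩ ?_
  · rw [← map_pow, ← map_pow, FiniteField.pow_card_sub_one_eq_one c hc, map_one, map_one]
  · rw [h.rlog_eq hC (s := 0) (by simp [h.norm_algebraMap _ (Polynomial.C_ne_zero.2 hc)]), hρ0]
    simp

theorem sgn_algebraMap (h : IsSignSystem F q ρ sgn) {a : Polynomial F} (ha : a ≠ 0) :
    sgn (algebraMap (Polynomial F) E a) =
      algebraMap (Polynomial F) E (Polynomial.C a.leadingCoeff) := by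
  induction hn : a.natDegree generalizing a with
  | zero =>
    obtain ⟨c, rfl⟩ := Polynomial.natDegree_eq_zero.1 hn
    rw [h.sgn_C (Polynomial.C_ne_zero.1 ha), Polynomial.leadingCoeff_C]
  | succ n ih =>
    have hdiv : a.divX ≠ 0 := by
      intro h0
      have := Polynomial.natDegree_divX_eq_natDegree_tsub_one (p := a)
      have hC := Polynomial.divX_mul_X_add a
      rw [h0, zero_mul, zero_add] at hC
      rw [← hC, Polynomial.natDegree_C] at hn
      omega
    have hdeg : a.divX.natDegree = n := by
      rw [Polynomial.natDegree_divX_eq_natDegree_tsub_one, hn, Nat.add_sub_cancel]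
    have hlead : a.divX.leadingCoeff = a.leadingCoeff := by
      rw [Polynomial.leadingCoeff, Polynomial.leadingCoeff, hdeg, hn, Polynomial.coeff_divX]
    have hX := h.algebraMap_ne_zero (Polynomial.X_ne_zero (R := F))
    rw [← hlead, ← ih hdiv hdeg]
    conv_lhs => rw [← Polynomial.divX_mul_X_add a]
    rw [map_add, h.sgn_add_of_norm_lt, map_mul,
      h.sgn_mul (h.algebraMap_ne_zero hdiv) hX, h.sgn_X, mul_one]
    rw [h.norm_algebraMap _ (mul_ne_zero hdiv Polynomial.X_ne_zero),
      Polynomial.natDegree_mul_X hdiv, hdeg]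
    have hpow : (1 : ℝ) < (q : ℝ) ^ (n + 1) := one_lt_pow₀ h.one_lt n.succ_ne_zero
    by_cases hc : a.coeff 0 = 0
    · simpa [hc] using zero_lt_one.trans hpow
    · simpa [h.norm_algebraMap _ (Polynomial.C_ne_zero.2 hc)] using hpow

theorem sgn_algebraMap_pow (h : IsSignSystem F q ρ sgn) {a : Polynomial F} (ha : a ≠ 0) (r : ℕ) :
    sgn (algebraMap (Polynomial F) E a) ^ q ^ r = sgn (algebraMap (Polynomial F) E a) := by
  rw [h.sgn_algebraMap ha, ← map_pow, ← map_pow, ← h.card_eq, FiniteField.pow_card_pow]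

theorem logq_le_iff (h : IsSignSystem F q ρ sgn) {z : E} (hz : z ≠ 0) (N : ℝ) :
    logq q z ≤ N ↔ ‖z‖ ≤ (q : ℝ) ^ N :=
  Real.logb_le_iff_le_rpow h.one_lt (norm_pos_iff.2 hz)

end IsSignSystem

/-- The sign function, extended by `1` at `0`. -/
def sgnOne {E : Type*} [Zero E] [One E] (sgn : E → E) (z : E) : E :=
  if z = 0 then 1 else sgn z

section LatticeBall

variable {F : Type*} [Field F] {E : Type*} [NormedField E] [Algebra (Polynomial F) E]
  {q r : ℕ} {ρ : ℚ → E} {sgn : E → E} {Λ : Submodule (Polynomial F) E}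

/-- The set of elements of norm at most `q ^ N` in a lattice, as a finset. -/
def latticeBall (hΛ : ∀ B : ℝ, {x : E | x ∈ Λ ∧ ‖x‖ ≤ B}.Finite) (q : ℕ) (N : ℚ) : Finset E :=
  (hΛ ((q : ℝ) ^ (N : ℝ))).toFinset

theorem mem_latticeBall {hΛ : ∀ B : ℝ, {x : E | x ∈ Λ ∧ ‖x‖ ≤ B}.Finite} {N : ℚ} {x : E} :
    x ∈ latticeBall hΛ q N ↔ x ∈ Λ ∧ ‖x‖ ≤ (q : ℝ) ^ (N : ℝ) := by
  simp [latticeBall]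

/-- The linear combination of `b` with constant coefficients `c`; for a basis `b` of `Λ` these
are representatives of `Λ / TΛ`. -/
def constCombination (b : Fin r → E) (c : Fin r → F) : E :=
  ∑ i, Polynomial.C (c i) • b i

theorem constCombination_add_X_smul (b : Fin r → E) (c : Fin r → F)
    (p : Fin r → Polynomial F) :
    constCombination b c + (Polynomial.X : Polynomial F) • ∑ i, p i • b i =
      ∑ i, (Polynomial.C (c i) + Polynomial.X * p i) • b i := by
  simp only [constCombination, Finset.smul_sum, ← Finset.sum_add_distrib, add_smul, mul_smul]

variable [Fintype F]

theorem IsSignSystem.norm_X_smul (h : IsSignSystem F q ρ sgn) (x : E) :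
    ‖(Polynomial.X : Polynomial F) • x‖ = q * ‖x‖ := by
  rw [Algebra.smul_def, norm_mul, h.norm_X]

theorem IsSignSystem.norm_X_smul_le_iff (h : IsSignSystem F q ρ sgn) (x : E) (N : ℚ) :
    ‖(Polynomial.X : Polynomial F) • x‖ ≤ (q : ℝ) ^ ((N + 1 : ℚ) : ℝ) ↔
      ‖x‖ ≤ (q : ℝ) ^ (N : ℝ) := by
  have hq := zero_lt_one.trans h.one_lt
  rw [h.norm_X_smul, Rat.cast_add, Rat.cast_one, Real.rpow_add hq, Real.rpow_one, mul_comm,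
    mul_le_mul_iff_left₀ hq]

/-- Every element of `Λ_{N+1}` is uniquely a representative of `Λ / TΛ` plus an element of
`TΛ_N`. -/
theorem IsSignSystem.bijOn_latticeBall (h : IsSignSystem F q ρ sgn)
    (hΛ : ∀ B : ℝ, {x : E | x ∈ Λ ∧ ‖x‖ ≤ B}.Finite) {b : Fin r → E}
    (hb : LinearIndependent (Polynomial F) b)
    (hspan : Submodule.span (Polynomial F) (Set.range b) = Λ) {N : ℚ}
    (hN : ∀ c : Fin r → F, ‖constCombination b c‖ ≤ (q : ℝ) ^ ((N + 1 : ℚ) : ℝ)) :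
    Set.BijOn (fun m : E × (Fin r → F) =>
        constCombination b m.2 + (Polynomial.X : Polynomial F) • m.1)
      (latticeBall hΛ q N ×ˢ (Finset.univ : Finset (Fin r → F)) : Finset _)
      (latticeBall hΛ q (N + 1)) := by
  have hmem : ∀ c : Fin r → F, constCombination b c ∈ Λ := fun c => by
    rw [← hspan]
    exact Submodule.sum_mem _ fun i _ =>
      Submodule.smul_mem _ _ (Submodule.subset_span (Set.mem_range_self i))
  refine ⟨?_, ?_, ?_⟩
  · rintro ⟨μ, c⟩ hμ
    simp only [Finset.coe_product, Set.mem_prod, Finset.mem_coe, mem_latticeBall] at hμ ⊢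
    exact ⟨Λ.add_mem (hmem c) (Λ.smul_mem _ hμ.1.1), (h.norm_add_le_max _ _).trans
      (max_le (hN c) ((h.norm_X_smul_le_iff _ _).2 hμ.1.2))⟩
  · rintro ⟨μ, c⟩ hμ ⟨μ', c'⟩ hμ' heq
    simp only [Finset.coe_product, Set.mem_prod, Finset.mem_coe, mem_latticeBall] at hμ hμ' heq
    obtain ⟨p, hp⟩ := Submodule.mem_span_range_iff_exists_fun _ |>.1 (hspan ▸ hμ.1.1)
    obtain ⟨p', hp'⟩ := Submodule.mem_span_range_iff_exists_fun _ |>.1 (hspan ▸ hμ'.1.1)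
    have hcoef : (fun i => Polynomial.C (c i) + Polynomial.X * p i) =
        fun i => Polynomial.C (c' i) + Polynomial.X * p' i := by
      refine hb.fintypeLinearCombination_injective ?_
      rw [Fintype.linearCombination_apply, Fintype.linearCombination_apply,
        ← constCombination_add_X_smul, ← constCombination_add_X_smul, hp, hp', heq]
    have hc : c = c' := funext fun i => by
      simpa using congrArg (Polynomial.coeff · 0) (congrFun hcoef i)
    subst hc
    have hX : ‖(Polynomial.X : Polynomial F) • (μ - μ')‖ = 0 := by
      rw [smul_sub, add_left_cancel heq, sub_self, norm_zero]
    rw [h.norm_X_smul, mul_eq_zero, or_iff_right (zero_lt_one.trans h.one_lt).ne', norm_eq_zero,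
      sub_eq_zero] at hX
    rw [hX]
  · intro x hx
    rw [Finset.mem_coe, mem_latticeBall] at hx
    obtain ⟨p, hp⟩ := Submodule.mem_span_range_iff_exists_fun _ |>.1 (hspan ▸ hx.1)
    set c : Fin r → F := fun i => (p i).coeff 0
    set μ : E := ∑ i, (p i).divX • b i
    have hsum : constCombination b c + (Polynomial.X : Polynomial F) • μ = x := by
      rw [constCombination_add_X_smul, ← hp]
      refine Finset.sum_congr rfl fun i _ => ?_
      rw [add_comm, Polynomial.X_mul, Polynomial.divX_mul_X_add]
    refine ⟨(μ, c), ?_, hsum⟩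
    simp only [Finset.coe_product, Set.mem_prod, Finset.mem_coe, mem_latticeBall,
      Finset.mem_univ, and_true]
    refine ⟨hspan ▸ Submodule.sum_mem _ fun i _ =>
      Submodule.smul_mem _ _ (Submodule.subset_span (Set.mem_range_self i)), ?_⟩
    rw [← h.norm_X_smul_le_iff, ← add_sub_cancel_left (constCombination b c) (_ • μ), hsum,
      sub_eq_add_neg]
    exact (h.norm_add_le_max _ _).trans (max_le hx.2 (by rw [norm_neg]; exact hN c))

theorem IsSignSystem.sgnProd_eq_prod (h : IsSignSystem F q ρ sgn) {N : ℚ} {S : Finset E}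
    (hS : ∀ x, x ∈ S ↔ x ∈ Λ ∧ ‖x‖ ≤ (q : ℝ) ^ (N : ℝ)) :
    sgnProd q sgn Λ 0 N = ∏ x ∈ S, sgnOne sgn x := by
  have hset : ballSet q Λ 0 N = (S.erase 0 : Finset E) := by
    ext x
    simp only [ballSet, Set.mem_ofPred_eq, sub_zero, Finset.coe_erase, Set.mem_sdiff,
      Finset.mem_coe, hS, Set.mem_singleton_iff]
    constructor
    · rintro ⟨h0, hx, hN⟩
      exact ⟨⟨hx, (h.logq_le_iff h0 _).1 hN⟩, h0⟩
    · rintro ⟨⟨hx, hN⟩, h0⟩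
      exact ⟨h0, hx, (h.logq_le_iff h0 _).2 hN⟩
  rw [sgnProd, hset, finprod_mem_coe_finset, ← Finset.prod_erase S (a := 0) (by simp [sgnOne])]
  exact Finset.prod_congr rfl fun x hx => by simp [sgnOne, Finset.ne_of_mem_erase hx]

theorem IsSignSystem.exists_sgnProd_pow_eq_one (h : IsSignSystem F q ρ sgn)
    (hΛ : ∀ B : ℝ, {x : E | x ∈ Λ ∧ ‖x‖ ≤ B}.Finite) (N : ℚ) :
    ∃ k : ℕ, 0 < k ∧ sgnProd q sgn Λ 0 N ^ k = 1 := by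
  rw [h.sgnProd_eq_prod (S := latticeBall hΛ q N) fun x => mem_latticeBall,
    ← isOfFinOrder_iff_pow_eq_one]
  refine Finset.prod_induction _ IsOfFinOrder (fun _ _ => IsOfFinOrder.mul) IsOfFinOrder.one ?_
  intro x _
  rw [sgnOne]
  split_ifs with hx
  · exact IsOfFinOrder.one
  · exact isOfFinOrder_iff_pow_eq_one.2 (h.sgn_spec x hx).1

theorem ne_zero_of_exists_pow_eq_one {x : E} (hx : ∃ k : ℕ, 0 < k ∧ x ^ k = 1) : x ≠ 0 := by
  obtain ⟨k, hk, hxk⟩ := hx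
  rintro rfl
  simp [hk.ne'] at hxk

/-- The number of elements and the product of signs of the balls `Λ_N` of a lattice, for `N` and
`N + 1`, with `N` large. -/
theorem IsSignSystem.exists_sgnProd_succ (h : IsSignSystem F q ρ sgn)
    (hΛ : ∀ B : ℝ, {x : E | x ∈ Λ ∧ ‖x‖ ≤ B}.Finite) {b : Fin r → E}
    (hb : LinearIndependent (Polynomial F) b)
    (hspan : Submodule.span (Polynomial F) (Set.range b) = Λ) :
    ∃ N₀ : ℚ, ∃ δ : E, ∀ N : ℚ, N₀ ≤ N →
      (latticeBall hΛ q (N + 1)).card = (latticeBall hΛ q N).card * q ^ r ∧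
      sgnProd q sgn Λ 0 (N + 1) = sgnProd q sgn Λ 0 N ^ q ^ r * δ := by
  have hq := zero_lt_one.trans h.one_lt
  have hmono : ∀ {M N : ℚ}, M ≤ N → (q : ℝ) ^ (M : ℝ) ≤ (q : ℝ) ^ (N : ℝ) := fun hMN =>
    Real.rpow_le_rpow_of_exponent_le h.one_lt.le (by exact_mod_cast hMN)
  obtain ⟨n, hn⟩ : ∃ n : ℕ, ∀ c : Fin r → F, ‖constCombination b c‖ ≤ (q : ℝ) ^ n := by
    obtain ⟨B, hB⟩ := (Set.finite_range fun c : Fin r → F => ‖constCombination b c‖).bddAbove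
    obtain ⟨n, hn⟩ := pow_unbounded_of_one_lt B h.one_lt
    exact ⟨n, fun c => (hB (Set.mem_range_self c)).trans hn.le⟩
  have hn' : ∀ c : Fin r → F, ‖constCombination b c‖ ≤ (q : ℝ) ^ ((n : ℚ) : ℝ) := fun c => by
    simpa using hn c
  let s : E → E := sgnOne sgn
  have hs : ∀ x, s x ≠ 0 := fun x => by
    simp only [s, sgnOne]
    split_ifs with hx
    · exact one_ne_zero
    · exact h.sgn_ne_zero hx
  let g : E → E := fun μ =>
    (∏ c : Fin r → F, s (constCombination b c + (Polynomial.X : Polynomial F) • μ)) /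
      s μ ^ q ^ r
  have hcard : Fintype.card (Fin r → F) = q ^ r := by simp [h.card_eq]
  refine ⟨n, ∏ μ ∈ latticeBall hΛ q n, g μ, fun N hN => ?_⟩
  have hbij := h.bijOn_latticeBall hΛ hb hspan (N := N)
    fun c => (hn' c).trans (hmono (hN.trans (le_add_of_nonneg_right zero_le_one)))
  refine ⟨?_, ?_⟩
  · rw [← Finset.card_nbij _ hbij.mapsTo hbij.injOn hbij.surjOn, Finset.card_product,
      Finset.card_univ, hcard]
  · have hsub : latticeBall hΛ q n ⊆ latticeBall hΛ q N := fun x hx => by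
      rw [mem_latticeBall] at hx ⊢
      exact ⟨hx.1, hx.2.trans (hmono hN)⟩
    rw [h.sgnProd_eq_prod (S := latticeBall hΛ q (N + 1)) fun x => mem_latticeBall,
      h.sgnProd_eq_prod (S := latticeBall hΛ q N) fun x => mem_latticeBall,
      ← Finset.prod_nbij _ hbij.mapsTo hbij.injOn hbij.surjOn fun _ _ => rfl,
      Finset.prod_product, ← Finset.prod_pow, Finset.prod_subset hsub, ← Finset.prod_mul_distrib]
    · exact Finset.prod_congr rfl fun μ _ =>
        (mul_div_cancel₀ _ (pow_ne_zero _ (hs μ))).symm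
    · intro μ hμ hμn
      have hlt : (q : ℝ) ^ ((n : ℚ) : ℝ) < ‖μ‖ := by
        by_contra! hle
        exact hμn (mem_latticeBall.2 ⟨(mem_latticeBall.1 hμ).1, hle⟩)
      have hμ0 : μ ≠ 0 := norm_pos_iff.1 ((Real.rpow_pos_of_pos hq _).trans hlt)
      have hXμ : ‖μ‖ ≤ ‖(Polynomial.X : Polynomial F) • μ‖ := by
        rw [h.norm_X_smul]
        exact le_mul_of_one_le_left (norm_nonneg _) h.one_lt.le
      have hterm : ∀ c : Fin r → F,
          s (constCombination b c + (Polynomial.X : Polynomial F) • μ) = s μ := fun c => by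
        have hclt := ((hn' c).trans_lt hlt).trans_le hXμ
        rw [add_comm]
        have hne : (Polynomial.X : Polynomial F) • μ + constCombination b c ≠ 0 := by
          rw [← norm_pos_iff, h.norm_add_eq hclt]
          exact (norm_nonneg _).trans_lt hclt
        simp only [s, sgnOne, hne, hμ0, if_false]
        rw [h.sgn_add_of_norm_lt hclt, Algebra.smul_def,
          h.sgn_mul (h.algebraMap_ne_zero Polynomial.X_ne_zero) hμ0, h.sgn_X, one_mul]
      simp only [g, hterm, Finset.prod_const, Finset.card_univ, hcard]
      exact div_self (pow_ne_zero _ (hs μ))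

theorem IsSignSystem.sgnProd_scaleSub (h : IsSignSystem F q ρ sgn)
    (hΛ : ∀ B : ℝ, {x : E | x ∈ Λ ∧ ‖x‖ ≤ B}.Finite) {c : E} (hc : c ≠ 0) (N : ℚ) :
    sgnProd q sgn (scaleSub c Λ) 0 N * sgn c =
      sgnProd q sgn Λ 0 (N - rlog q c) * sgn c ^ (latticeBall hΛ q (N - rlog q c)).card := by
  have hq := zero_lt_one.trans h.one_lt
  have hS : ∀ x, x ∈ (latticeBall hΛ q (N - rlog q c)).image (c * ·) ↔
      x ∈ scaleSub c Λ ∧ ‖x‖ ≤ (q : ℝ) ^ (N : ℝ) := fun x => by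
    have hnorm : ∀ y : E,
        ‖y‖ ≤ (q : ℝ) ^ ((N - rlog q c : ℚ) : ℝ) ↔ ‖c * y‖ ≤ (q : ℝ) ^ (N : ℝ) := fun y => by
      rw [norm_mul, Rat.cast_sub, Real.rpow_sub hq, ← h.norm_eq_rpow_rlog hc,
        le_div_iff₀' (norm_pos_iff.2 hc)]
    simp only [Finset.mem_image, mem_latticeBall, scaleSub, Submodule.mem_map,
      LinearMap.mulLeft_apply, hnorm]
    constructor
    · rintro ⟨y, ⟨hy, hle⟩, rfl⟩
      exact ⟨⟨y, hy, rfl⟩, hle⟩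
    · rintro ⟨⟨y, hy, rfl⟩, hle⟩
      exact ⟨y, ⟨hy, hle⟩, rfl⟩
  have hzero : (0 : E) ∈ latticeBall hΛ q (N - rlog q c) := by
    rw [mem_latticeBall, norm_zero]
    exact ⟨Λ.zero_mem, (Real.rpow_pos_of_pos hq _).le⟩
  rw [h.sgnProd_eq_prod hS, h.sgnProd_eq_prod (S := latticeBall hΛ q (N - rlog q c))
    fun x => mem_latticeBall, Finset.prod_image fun x _ y _ hxy => mul_left_cancel₀ hc hxy,
    ← Finset.mul_prod_erase _ _ hzero, ← Finset.mul_prod_erase _ (sgnOne sgn) hzero,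
    ← Finset.card_erase_add_one hzero, pow_succ, ← Finset.prod_const, ← mul_assoc, mul_assoc
    (sgnOne sgn 0), ← Finset.prod_mul_distrib, mul_zero]
  refine congrArg (_ * · * _) (Finset.prod_congr rfl fun x hx => ?_)
  have hx0 := Finset.ne_of_mem_erase hx
  simp [sgnOne, hx0, hc, h.sgn_mul hc hx0, mul_comm]

end LatticeBall

/-- There are `N₀ ∈ ℚ` and a root of unity `ε^Λ` with
`ε(Λ_N)^{q^{rd}}·ε(Λ_{N+d})⁻¹ = (ε^Λ)^{(q^{rd}-1)/(q^r-1)}` for all rational `N ≥ N₀` and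
integers `d ≥ 1`; in particular `ε^Λ = ε(Λ_N)^{q^r}·ε(Λ_{N+1})⁻¹` is independent of
`N ≥ N₀`, an invariant of `Λ`, and `ε^{cΛ} = ε^Λ` for `0 ≠ c ∈ K`. -/
theorem statement13
    (q : ℕ) (hq : Fintype.card Fq = q)
    (hna : ∀ x y : L, ‖x + y‖ ≤ max ‖x‖ ‖y‖)
    (hA : ∀ a : Polynomial Fq, a ≠ 0 →
      ‖algebraMap (Polynomial Fq) L a‖ = (q : ℝ) ^ a.natDegree)
    (hval : ∀ x : L, x ≠ 0 → ∃ s : ℚ, ‖x‖ = (q : ℝ) ^ (s : ℝ))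
    (ρ : ℚ → L) (sgn : L → L)
    (hρ : ∀ x y : ℚ, ρ (x + y) = ρ x * ρ y)
    (hρ1 : ρ 1 * algebraMap (Polynomial Fq) L Polynomial.X = 1)
    (hsgn : ∀ z : L, z ≠ 0 →
      (∃ k : ℕ, 0 < k ∧ sgn z ^ k = 1) ∧ ‖uPart q ρ sgn z - 1‖ < 1)
    (r : ℕ)
    (Λ : Submodule (Polynomial Fq) L) (hΛ : IsLatticeOfRank r Λ) :
    ∃ N₀ : ℚ, ∃ ε : L, (∃ k : ℕ, 0 < k ∧ ε ^ k = 1) ∧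
      (∀ N : ℚ, N₀ ≤ N → ∀ d : ℕ, 1 ≤ d →
        sgnProd q sgn Λ 0 N ^ (q ^ (r * d)) * (sgnProd q sgn Λ 0 (N + d))⁻¹ =
          ε ^ (∑ j ∈ Finset.range d, q ^ (r * j))) ∧
      (∀ N : ℚ, N₀ ≤ N →
        ε = sgnProd q sgn Λ 0 N ^ (q ^ r) * (sgnProd q sgn Λ 0 (N + 1))⁻¹) ∧
      (∀ a b : Polynomial Fq, a ≠ 0 → b ≠ 0 →
        ∃ N₁ : ℚ, ∀ N : ℚ, N₁ ≤ N →
          ε = sgnProd q sgn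
                (scaleSub (algebraMap (Polynomial Fq) L a / algebraMap (Polynomial Fq) L b) Λ)
                0 N ^ (q ^ r) *
              (sgnProd q sgn
                (scaleSub (algebraMap (Polynomial Fq) L a / algebraMap (Polynomial Fq) L b) Λ)
                0 (N + 1))⁻¹) := by
  have h : IsSignSystem Fq q ρ sgn := ⟨hq, hna, hA, hval, hρ, hρ1, hsgn⟩
  obtain ⟨⟨b, hb, hspan⟩, hfin⟩ := hΛ
  obtain ⟨N₀, δ, hstep⟩ := h.exists_sgnProd_succ hfin hb hspan
  have hne : ∀ N : ℚ, sgnProd q sgn Λ 0 N ≠ 0 := fun N =>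
    ne_zero_of_exists_pow_eq_one (h.exists_sgnProd_pow_eq_one hfin N)
  have hδ : δ ≠ 0 := by
    have hsucc := (hstep N₀ le_rfl).2
    rintro rfl
    exact hne _ (hsucc.trans (mul_zero _))
  have hinv : ∀ N : ℚ, N₀ ≤ N →
      δ⁻¹ = sgnProd q sgn Λ 0 N ^ q ^ r * (sgnProd q sgn Λ 0 (N + 1))⁻¹ := fun N hN => by
    rw [(hstep N hN).2, mul_inv, mul_inv_cancel_left₀ (pow_ne_zero _ (hne N))]
  refine ⟨N₀, δ⁻¹, ?_, fun N hN d hd => ?_, hinv, fun a b ha hb => ?_⟩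
  · obtain ⟨k, hk, hk1⟩ := h.exists_sgnProd_pow_eq_one hfin N₀
    obtain ⟨l, hl, hl1⟩ := h.exists_sgnProd_pow_eq_one hfin (N₀ + 1)
    refine ⟨k * l, Nat.mul_pos hk hl, ?_⟩
    rw [hinv N₀ le_rfl, mul_pow, ← pow_mul, mul_left_comm, mul_comm (q ^ r), ← mul_assoc,
      mul_assoc, pow_mul, hk1, one_pow, inv_pow, mul_comm k, pow_mul, hl1, one_pow, inv_one,
      mul_one]
  · clear hd
    induction d with
    | zero => simp [hne N]
    | succ d ih =>
      have hd : N₀ ≤ N + d := hN.trans (le_add_of_nonneg_right d.cast_nonneg)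
      rw [Finset.sum_range_succ', mul_zero, pow_zero, pow_succ δ⁻¹]
      simp only [Nat.mul_add, mul_one, pow_add, ← Finset.sum_mul]
      rw [pow_mul δ⁻¹, ← ih, Nat.cast_succ, ← add_assoc, (hstep _ hd).2, mul_pow, ← pow_mul,
        inv_pow, mul_inv, mul_assoc]
  · have ha' := h.algebraMap_ne_zero ha
    have hb' := h.algebraMap_ne_zero hb
    set c := algebraMap (Polynomial Fq) L a / algebraMap (Polynomial Fq) L b
    have hc : c ≠ 0 := div_ne_zero ha' hb'
    have hsc := h.sgn_ne_zero hc
    have hpow : sgn c ^ q ^ r = sgn c := by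
      have hmul : sgn c * sgn (algebraMap (Polynomial Fq) L b) =
          sgn (algebraMap (Polynomial Fq) L a) := by
        rw [← h.sgn_mul hc hb', div_mul_cancel₀ _ hb']
      rw [← eq_div_iff (h.sgn_ne_zero hb')] at hmul
      rw [hmul, div_pow, h.sgn_algebraMap_pow ha, h.sgn_algebraMap_pow hb]
    refine ⟨N₀ + rlog q c, fun N hN => ?_⟩
    have hN' : N₀ ≤ N - rlog q c := le_sub_iff_add_le.2 hN
    have hscale := h.sgnProd_scaleSub hfin hc N
    have hscale' := h.sgnProd_scaleSub hfin hc (N + 1)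
    rw [add_sub_right_comm, (hstep _ hN').1, (hstep _ hN').2, pow_mul] at hscale'
    have hscale_pow := congrArg (· ^ q ^ r) hscale
    simp only [mul_pow, hpow] at hscale_pow
    rw [eq_mul_inv_iff_mul_eq₀, inv_mul_eq_iff_eq_mul₀ hδ]
    · refine mul_right_cancel₀ hsc ?_
      rw [hscale', mul_assoc δ, hscale_pow]
      ring
    · refine left_ne_zero_of_mul (b := sgn c) ?_
      rw [hscale']
      exact mul_ne_zero (mul_ne_zero (pow_ne_zero _ (hne _)) hδ)
        (pow_ne_zero _ (pow_ne_zero _ hsc))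
end
end

section
/- Let Λ be an A-lattice of rank r in L and u ∈ K·Λ ∖ Λ. Then there exist N₀ ∈ ℚ and a root of unity ε_u^Λ ∈ L^× such that for every rational N ≥ N₀: ∏_{0≠λ∈u+Λ, log λ ≤ N} sgn(λ) = ε_u^Λ · ε(Λ_N). The value ε_u^Λ depends only on the class of u modulo Λ, and for every nonzero c ∈ K one has ε_{cu}^{cΛ} = sgn(c)·ε_u^Λ. -/
open scoped Classical

noncomputable section

variable {Fq : Type*} [Field Fq] [Fintype Fq]
variable {L : Type*} [NormedField L] [CompleteSpace L]
variable [Algebra (Polynomial Fq) L]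

section Sign

variable {M : Type*} [NormedField M]

theorem IsOfFinOrder.inv_of_field {x : M} (hx : IsOfFinOrder x) : IsOfFinOrder x⁻¹ := by
  rw [isOfFinOrder_iff_pow_eq_one] at hx ⊢
  obtain ⟨k, hk, h⟩ := hx
  exact ⟨k, hk, by rw [inv_pow, h, inv_one]⟩

theorem isOfFinOrder_ne_zero {x : M} (hx : IsOfFinOrder x) : x ≠ 0 := by
  rintro rfl
  obtain ⟨k, hk, h⟩ := isOfFinOrder_iff_pow_eq_one.1 hx
  simp [hk.ne'] at h

theorem isOfFinOrder_norm_eq_one {x : M} (hx : IsOfFinOrder x) : ‖x‖ = 1 := by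
  obtain ⟨k, hk, h⟩ := isOfFinOrder_iff_pow_eq_one.1 hx
  exact (pow_eq_one_iff_of_nonneg (norm_nonneg x) hk.ne').1 (by rw [← norm_pow, h, norm_one])

theorem norm_natCast_eq_one_of_charP (p : ℕ) [Fact p.Prime] [CharP M p] {m : ℕ}
    (hm : ¬ p ∣ m) : ‖(m : M)‖ = 1 := by
  have h0 : (m : ZMod p) ≠ 0 := by rwa [Ne, ZMod.natCast_eq_zero_iff]
  have h1 : (m : M) ^ (p - 1) = 1 := by
    have h := congrArg (ZMod.castHom (dvd_refl p) M) (ZMod.pow_card_sub_one_eq_one h0)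
    simpa only [map_pow, map_natCast, map_one] using h
  exact isOfFinOrder_norm_eq_one (isOfFinOrder_iff_pow_eq_one.2
    ⟨p - 1, Nat.sub_pos_of_lt (Fact.out : p.Prime).one_lt, h1⟩)

theorem norm_eq_of_norm_sub_lt [IsUltrametricDist M] {x y : M} (h : ‖x - y‖ < ‖y‖) :
    ‖x‖ = ‖y‖ := by
  rw [← norm_neg y]
  exact IsUltrametricDist.norm_eq_of_add_norm_lt_max
    (by rw [← sub_eq_add_neg]; exact h.trans_le (by rw [norm_neg]; exact le_max_right _ _))

theorem norm_mul_sub_mul_lt_one [IsUltrametricDist M] {x y a b : M} (hy : ‖y‖ ≤ 1)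
    (ha : ‖a‖ ≤ 1) (hx : ‖x - a‖ < 1) (hyb : ‖y - b‖ < 1) : ‖x * y - a * b‖ < 1 := by
  have h : x * y - a * b = (x - a) * y + a * (y - b) := by ring
  rw [h]
  refine (IsUltrametricDist.norm_add_le_max _ _).trans_lt (max_lt ?_ ?_)
  · rw [norm_mul]
    exact (mul_le_of_le_one_right (norm_nonneg _) hy).trans_lt hx
  · rw [norm_mul]
    exact (mul_le_of_le_one_left (norm_nonneg _) ha).trans_lt hyb

/-- In residue characteristic equal to the characteristic, `1` is the only root of unity which
is a `1`-unit. -/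
theorem eq_one_of_isOfFinOrder_of_norm_sub_one_lt [IsUltrametricDist M] (p : ℕ) [Fact p.Prime]
    [CharP M p] {x : M} (hx : IsOfFinOrder x) (h : ‖x - 1‖ < 1) : x = 1 := by
  obtain ⟨k, hk, hxk⟩ := isOfFinOrder_iff_pow_eq_one.1 hx
  obtain ⟨a, m, hm, rfl⟩ :=
    Nat.exists_eq_pow_mul_and_not_dvd hk.ne' p (Fact.out : p.Prime).ne_one
  have hxm : x ^ m = 1 := by
    have h1 : (x ^ m - 1) ^ p ^ a = 0 := by
      rw [sub_pow_char_pow, one_pow, ← pow_mul, mul_comm, hxk, sub_self]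
    exact sub_eq_zero.1 (eq_zero_of_pow_eq_zero h1)
  have hx1 : ‖x‖ = 1 := isOfFinOrder_norm_eq_one hx
  have hpow : ∀ i : ℕ, ‖x ^ i - 1‖ < 1 := by
    intro i
    induction i with
    | zero => simp
    | succ i ih =>
      simpa [pow_succ] using norm_mul_sub_mul_lt_one hx1.le norm_one.le ih h
  have hsum : ∀ n : ℕ, ‖∑ i ∈ Finset.range n, x ^ i - (n : M)‖ < 1 := by
    intro n
    induction n with
    | zero => simp
    | succ n ih =>
      rw [Finset.sum_range_succ, Nat.cast_succ, add_sub_add_comm]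
      exact (IsUltrametricDist.norm_add_le_max _ _).trans_lt (max_lt ih (hpow n))
  have hprod := mul_geom_sum x m
  rw [hxm, sub_self, mul_eq_zero, sub_eq_zero] at hprod
  refine hprod.resolve_right fun h0 => ?_
  have := hsum m
  rw [h0, zero_sub, norm_neg, norm_natCast_eq_one_of_charP p hm] at this
  exact lt_irrefl _ this

theorem eq_of_isOfFinOrder_of_norm_sub_lt [IsUltrametricDist M] (p : ℕ) [Fact p.Prime]
    [CharP M p] {x y : M} (hx : IsOfFinOrder x) (hy : IsOfFinOrder y) (h : ‖x - y‖ < 1) :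
    x = y := by
  have hy0 := isOfFinOrder_ne_zero hy
  have hd : x * y⁻¹ = 1 := by
    refine eq_one_of_isOfFinOrder_of_norm_sub_one_lt p (hx.mul hy.inv_of_field) ?_
    have e : x * y⁻¹ - 1 = (x - y) * y⁻¹ := by field_simp
    rwa [e, norm_mul, isOfFinOrder_norm_eq_one hy.inv_of_field, mul_one]
  rwa [mul_inv_eq_one₀ hy0] at hd

/-- The properties of a sign function which determine the behaviour of sign products. -/
structure IsSign (sgn : M → M) : Prop where
  isOfFinOrder : ∀ z, z ≠ 0 → IsOfFinOrder (sgn z)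
  map_mul : ∀ z w, z ≠ 0 → w ≠ 0 → sgn (z * w) = sgn z * sgn w
  eq_of_norm_sub_lt : ∀ z w, ‖z - w‖ < ‖w‖ → sgn z = sgn w

theorem norm_eq_rpow_rlog {q : ℕ} {z : M} (h : ∃ s : ℚ, ‖z‖ = (q : ℝ) ^ (s : ℝ)) :
    ‖z‖ = (q : ℝ) ^ (rlog q z : ℝ) := by
  rw [rlog, dif_pos h]
  exact h.choose_spec

theorem rlog_eq {q : ℕ} (hq : 1 < q) {z : M} {s : ℚ} (h : ‖z‖ = (q : ℝ) ^ (s : ℝ)) :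
    rlog q z = s := by
  have h1 := norm_eq_rpow_rlog ⟨s, h⟩
  rw [h] at h1
  have hq' : (1 : ℝ) < q := by exact_mod_cast hq
  have := (Real.strictMono_rpow_of_base_gt_one hq').injective h1
  exact_mod_cast this.symm

theorem isSign_of_uPart [IsUltrametricDist M] (p : ℕ) [Fact p.Prime] [CharP M p]
    {q : ℕ} (hq : 1 < q)
    (hval : ∀ x : M, x ≠ 0 → ∃ s : ℚ, ‖x‖ = (q : ℝ) ^ (s : ℝ))
    {ρ : ℚ → M} {sgn : M → M} (hρ : ∀ x y : ℚ, ρ (x + y) = ρ x * ρ y)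
    (hsgn : ∀ z : M, z ≠ 0 →
      (∃ k : ℕ, 0 < k ∧ sgn z ^ k = 1) ∧ ‖uPart q ρ sgn z - 1‖ < 1) : IsSign sgn := by
  have hfin : ∀ z, z ≠ 0 → IsOfFinOrder (sgn z) := fun z hz =>
    isOfFinOrder_iff_pow_eq_one.2 (hsgn z hz).1
  have hclose : ∀ z, z ≠ 0 → ‖z * ρ (rlog q z) - sgn z‖ < 1 := by
    intro z hz
    have h0 := isOfFinOrder_ne_zero (hfin z hz)
    have h1 := (hsgn z hz).2
    have e : z * ρ (rlog q z) - sgn z = (uPart q ρ sgn z - 1) * sgn z := by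
      rw [uPart]; field_simp
    rwa [e, norm_mul, isOfFinOrder_norm_eq_one (hfin z hz), mul_one]
  have hunit : ∀ z, z ≠ 0 → ‖z * ρ (rlog q z)‖ = 1 := by
    intro z hz
    have h1 := isOfFinOrder_norm_eq_one (hfin z hz)
    rw [← h1]
    exact norm_eq_of_norm_sub_lt (h1.symm ▸ hclose z hz)
  have hq0 : (0 : ℝ) < q := by exact_mod_cast hq.pos
  refine ⟨hfin, fun z w hz hw => ?_, fun z w hzw => ?_⟩
  · have hlog : rlog q (z * w) = rlog q z + rlog q w := by
      refine rlog_eq hq ?_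
      rw [norm_mul, norm_eq_rpow_rlog (hval z hz), norm_eq_rpow_rlog (hval w hw),
        Rat.cast_add, Real.rpow_add hq0]
    refine eq_of_isOfFinOrder_of_norm_sub_lt p (hfin _ (mul_ne_zero hz hw))
      ((hfin z hz).mul (hfin w hw)) ?_
    have h1 := norm_mul_sub_mul_lt_one (hunit w hw).le
      (isOfFinOrder_norm_eq_one (hfin z hz)).le (hclose z hz) (hclose w hw)
    have h2 := hclose _ (mul_ne_zero hz hw)
    rw [hlog, hρ, mul_mul_mul_comm, norm_sub_rev] at h2
    rw [← sub_add_sub_cancel _ (z * ρ (rlog q z) * (w * ρ (rlog q w)))]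
    exact (IsUltrametricDist.norm_add_le_max _ _).trans_lt (max_lt h2 h1)
  · have hw : w ≠ 0 := norm_pos_iff.1 ((norm_nonneg _).trans_lt hzw)
    have hnorm : ‖z‖ = ‖w‖ := norm_eq_of_norm_sub_lt hzw
    have hz : z ≠ 0 := by rwa [← norm_ne_zero_iff, hnorm, norm_ne_zero_iff]
    have hlog : rlog q z = rlog q w := by simp only [rlog, hnorm]
    refine eq_of_isOfFinOrder_of_norm_sub_lt p (hfin z hz) (hfin w hw) ?_
    have h1 := hclose z hz
    rw [hlog, norm_sub_rev] at h1
    have h2 : ‖z * ρ (rlog q w) - w * ρ (rlog q w)‖ < 1 := by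
      rw [← sub_mul, norm_mul, ← hunit w hw, norm_mul]
      refine mul_lt_mul_of_pos_right hzw (norm_pos_iff.2 fun h => ?_)
      have := hunit w hw
      simp [h] at this
    rw [← sub_add_sub_cancel _ (z * ρ (rlog q w)), ← sub_add_sub_cancel (z * ρ (rlog q w))
      (w * ρ (rlog q w)) (sgn w)]
    exact (IsUltrametricDist.norm_add_le_max _ _).trans_lt (max_lt h1
      ((IsUltrametricDist.norm_add_le_max _ _).trans_lt (max_lt h2 (hclose w hw))))

end Sign

section Ball

variable {F : Type*} [Field F] {M : Type*} [NormedField M] [Algebra (Polynomial F) M]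

theorem logq_le_iff {q : ℕ} (hq : 1 < q) {z : M} (hz : z ≠ 0) {N : ℝ} :
    logq q z ≤ N ↔ ‖z‖ ≤ (q : ℝ) ^ N :=
  Real.logb_le_iff_le_rpow (by exact_mod_cast hq) (norm_pos_iff.2 hz)

theorem ballSet_congr (q : ℕ) {Λ : Submodule (Polynomial F) M} {u v : M} (h : u - v ∈ Λ)
    (N : ℚ) : ballSet q Λ v N = ballSet q Λ u N := by
  ext l
  have : l - v ∈ Λ ↔ l - u ∈ Λ := by
    rw [← sub_add_sub_cancel l u v]
    exact Λ.add_mem_iff_left h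
  simp only [ballSet, Set.mem_ofPred_eq, this]

theorem ballSet_zero_finite {q : ℕ} (hq : 1 < q) {Λ : Submodule (Polynomial F) M}
    (hΛ : ∀ B : ℝ, {x : M | x ∈ Λ ∧ ‖x‖ ≤ B}.Finite) (N : ℚ) :
    (ballSet q Λ 0 N).Finite := by
  refine (hΛ ((q : ℝ) ^ (N : ℝ))).subset fun l hl => ?_
  exact ⟨by simpa using hl.2.1, (logq_le_iff hq hl.1).1 hl.2.2⟩

theorem ballSet_mono (q : ℕ) (Λ : Submodule (Polynomial F) M) (u : M) {N N' : ℚ} (h : N ≤ N') :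
    ballSet q Λ u N ⊆ ballSet q Λ u N' := fun _ hl =>
  ⟨hl.1, hl.2.1, hl.2.2.trans (by exact_mod_cast h)⟩

theorem ballSet_eq_insert [IsUltrametricDist M] {q : ℕ} (hq : 1 < q)
    {Λ : Submodule (Polynomial F) M} {u : M} (hu : u ∉ Λ) {N : ℚ} (hN : logq q u ≤ N) :
    ballSet q Λ u N = insert u ((fun l => l + u) '' ballSet q Λ 0 N) := by
  have hu0 : u ≠ 0 := fun h => hu (h ▸ Λ.zero_mem)
  have huN := (logq_le_iff hq hu0).1 hN
  ext l
  simp only [Set.mem_insert_iff, Set.mem_image, ballSet, Set.mem_ofPred_eq, sub_zero]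
  constructor
  · rintro ⟨hl0, hl, hlN⟩
    refine or_iff_not_imp_left.2 fun hne => ⟨l - u, ⟨sub_ne_zero.2 hne, hl, ?_⟩, by ring⟩
    rw [logq_le_iff hq (sub_ne_zero.2 hne)]
    rw [sub_eq_add_neg]
    exact (IsUltrametricDist.norm_add_le_max _ _).trans
      (max_le ((logq_le_iff hq hl0).1 hlN) ((norm_neg u).trans_le huN))
  · rintro (rfl | ⟨x, ⟨hx0, hx, hxN⟩, rfl⟩)
    · exact ⟨hu0, by simp, hN⟩
    · have h0 : x + u ≠ 0 := fun h => hu (by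
        rw [eq_neg_of_add_eq_zero_right h]; exact Λ.neg_mem hx)
      refine ⟨h0, by simpa using hx, ?_⟩
      rw [logq_le_iff hq h0]
      exact (IsUltrametricDist.norm_add_le_max _ _).trans
        (max_le ((logq_le_iff hq hx0).1 hxN) huN)

theorem notMem_image_add_ballSet (q : ℕ) (Λ : Submodule (Polynomial F) M) (u : M) (N : ℚ) :
    u ∉ (fun l => l + u) '' ballSet q Λ 0 N := by
  rintro ⟨x, hx, h⟩
  exact hx.1 (by simpa using h)

theorem ncard_ballSet [IsUltrametricDist M] {q : ℕ} (hq : 1 < q)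
    {Λ : Submodule (Polynomial F) M} (hΛ : ∀ B : ℝ, {x : M | x ∈ Λ ∧ ‖x‖ ≤ B}.Finite)
    {u : M} (hu : u ∉ Λ) {N : ℚ} (hN : logq q u ≤ N) :
    (ballSet q Λ u N).ncard = (ballSet q Λ 0 N).ncard + 1 := by
  rw [ballSet_eq_insert hq hu hN, Set.ncard_insert_of_notMem (notMem_image_add_ballSet q Λ u N)
    ((ballSet_zero_finite hq hΛ N).image _), Set.ncard_image_of_injective _ (add_left_injective u)]

theorem sgnProd_eq_mul [IsUltrametricDist M] {q : ℕ} (hq : 1 < q) {sgn : M → M}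
    (hs : IsSign sgn) {Λ : Submodule (Polynomial F) M}
    (hΛ : ∀ B : ℝ, {x : M | x ∈ Λ ∧ ‖x‖ ≤ B}.Finite)
    {u : M} (hu : u ∉ Λ) {N₀ N : ℚ} (hN₀ : logq q u ≤ N₀) (hN : N₀ ≤ N) :
    sgnProd q sgn Λ u N =
      (sgn u * ∏ᶠ l ∈ ballSet q Λ 0 N₀, sgn (l + u) * (sgn l)⁻¹) * sgnProd q sgn Λ 0 N := by
  have hNu : logq q u ≤ N := hN₀.trans (by exact_mod_cast hN)
  have hfin := ballSet_zero_finite hq hΛ N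
  have hfin₀ := ballSet_zero_finite hq hΛ N₀
  have hu0 : u ≠ 0 := fun h => hu (h ▸ Λ.zero_mem)
  rw [sgnProd, ballSet_eq_insert hq hu hNu,
    finprod_mem_insert _ (notMem_image_add_ballSet q Λ u N) (hfin.image _),
    finprod_mem_image (add_left_injective u).injOn, sgnProd, mul_assoc,
    finprod_mem_eq_finite_toFinset_prod _ hfin, finprod_mem_eq_finite_toFinset_prod _ hfin,
    finprod_mem_eq_finite_toFinset_prod _ hfin₀]
  have hsub : hfin₀.toFinset ⊆ hfin.toFinset :=
    Set.Finite.toFinset_subset_toFinset.2 (ballSet_mono q Λ 0 hN)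
  rw [Finset.prod_subset hsub, ← Finset.prod_mul_distrib]
  · congr 1
    refine Finset.prod_congr rfl fun l hl => ?_
    have hl0 : l ≠ 0 := (hfin.mem_toFinset.1 hl).1
    rw [inv_mul_cancel_right₀ (isOfFinOrder_ne_zero (hs.isOfFinOrder l hl0))]
  · intro l hl hl'
    rw [Set.Finite.mem_toFinset] at hl hl'
    have hlt : ‖u‖ < ‖l‖ := by
      by_contra! hle
      refine hl' ⟨hl.1, hl.2.1, ?_⟩
      exact (logq_le_iff hq hl.1).2 (hle.trans ((logq_le_iff hq hu0).1 hN₀))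
    rw [hs.eq_of_norm_sub_lt (l + u) l (by simpa using hlt),
      mul_inv_cancel₀ (isOfFinOrder_ne_zero (hs.isOfFinOrder l hl.1))]

theorem ballSet_scaleSub (q : ℕ) (Λ : Submodule (Polynomial F) M) (u : M) {c : M} (hc : c ≠ 0)
    {d : ℚ} (hd : logq q c = d) (N : ℚ) :
    ballSet q (scaleSub c Λ) (c * u) N = (fun l => c * l) '' ballSet q Λ u (N - d) := by
  have hlog : ∀ l : M, l ≠ 0 → (logq q (c * l) ≤ (N : ℝ) ↔ logq q l ≤ ((N - d : ℚ) : ℝ)) := by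
    intro l hl
    have : logq q (c * l) = d + logq q l := by
      rw [← hd, logq, logq, logq, norm_mul,
        Real.logb_mul (norm_ne_zero_iff.2 hc) (norm_ne_zero_iff.2 hl)]
    rw [this, Rat.cast_sub, le_sub_iff_add_le']
  ext l
  simp only [Set.mem_image, ballSet, Set.mem_ofPred_eq, scaleSub, Submodule.mem_map,
    LinearMap.mulLeft_apply]
  constructor
  · rintro ⟨hl0, ⟨x, hx, hxl⟩, hlN⟩
    have hl : l = c * (x + u) := by rw [mul_add, hxl, sub_add_cancel]
    have h0 : x + u ≠ 0 := by rintro h; rw [h, mul_zero] at hl; exact hl0 hl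
    refine ⟨x + u, ⟨h0, by simpa using hx, ?_⟩, hl.symm⟩
    rwa [← hlog _ h0, ← hl]
  · rintro ⟨x, ⟨hx0, hx, hxN⟩, rfl⟩
    exact ⟨mul_ne_zero hc hx0, ⟨x - u, hx, mul_sub _ _ _⟩, (hlog x hx0).2 hxN⟩

theorem sgnProd_scaleSub {q : ℕ} {sgn : M → M} (hs : IsSign sgn)
    {Λ : Submodule (Polynomial F) M} {u c : M} (hc : c ≠ 0) {d : ℚ} (hd : logq q c = d) (N : ℚ)
    (hfin : (ballSet q Λ u (N - d)).Finite) :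
    sgnProd q sgn (scaleSub c Λ) (c * u) N =
      sgn c ^ (ballSet q Λ u (N - d)).ncard * sgnProd q sgn Λ u (N - d) := by
  rw [sgnProd, ballSet_scaleSub q Λ u hc hd, finprod_mem_image (mul_right_injective₀ hc).injOn,
    sgnProd, finprod_mem_eq_finite_toFinset_prod _ hfin,
    finprod_mem_eq_finite_toFinset_prod _ hfin, Set.ncard_eq_toFinset_card _ hfin,
    ← Finset.prod_const, ← Finset.prod_mul_distrib]
  exact Finset.prod_congr rfl fun l hl =>
    hs.map_mul c l hc (hfin.mem_toFinset.1 hl).1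

end Ball

/-- For `u ∈ K·Λ ∖ Λ` there are `N₀ ∈ ℚ` and a root of unity `ε_u^Λ`
with `∏_{0≠λ∈u+Λ, log λ ≤ N} sgn λ = ε_u^Λ·ε(Λ_N)` for all rational `N ≥ N₀`; the value
`ε_u^Λ` depends only on the class of `u` mod `Λ`, and `ε_{cu}^{cΛ} = sgn(c)·ε_u^Λ` for
every `0 ≠ c ∈ K`. -/
theorem statement14
    (q : ℕ) (hq : Fintype.card Fq = q)
    (hna : ∀ x y : L, ‖x + y‖ ≤ max ‖x‖ ‖y‖)
    (hA : ∀ a : Polynomial Fq, a ≠ 0 →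
      ‖algebraMap (Polynomial Fq) L a‖ = (q : ℝ) ^ a.natDegree)
    (hval : ∀ x : L, x ≠ 0 → ∃ s : ℚ, ‖x‖ = (q : ℝ) ^ (s : ℝ))
    (ρ : ℚ → L) (sgn : L → L)
    (hρ : ∀ x y : ℚ, ρ (x + y) = ρ x * ρ y)
    (hρ1 : ρ 1 * algebraMap (Polynomial Fq) L Polynomial.X = 1)
    (hsgn : ∀ z : L, z ≠ 0 →
      (∃ k : ℕ, 0 < k ∧ sgn z ^ k = 1) ∧ ‖uPart q ρ sgn z - 1‖ < 1)
    (r : ℕ)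
    (Λ : Submodule (Polynomial Fq) L) (hΛ : IsLatticeOfRank r Λ)
    (u : L) (hu : InKSpan Λ u) (huΛ : u ∉ Λ) :
    ∃ N₀ : ℚ, ∃ ε : L, (∃ k : ℕ, 0 < k ∧ ε ^ k = 1) ∧
      (∀ N : ℚ, N₀ ≤ N → sgnProd q sgn Λ u N = ε * sgnProd q sgn Λ 0 N) ∧
      (∀ u' : L, u - u' ∈ Λ →
        ∃ N₁ : ℚ, ∀ N : ℚ, N₁ ≤ N → sgnProd q sgn Λ u' N = ε * sgnProd q sgn Λ 0 N) ∧
      (∀ a b : Polynomial Fq, a ≠ 0 → b ≠ 0 →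
        ∃ N₂ : ℚ, ∀ N : ℚ, N₂ ≤ N →
          sgnProd q sgn
              (scaleSub (algebraMap (Polynomial Fq) L a / algebraMap (Polynomial Fq) L b) Λ)
              (algebraMap (Polynomial Fq) L a / algebraMap (Polynomial Fq) L b * u) N =
            (sgn (algebraMap (Polynomial Fq) L a / algebraMap (Polynomial Fq) L b) * ε) *
              sgnProd q sgn
                (scaleSub (algebraMap (Polynomial Fq) L a / algebraMap (Polynomial Fq) L b) Λ)
                0 N) := by
  have hq1 : 1 < q := hq ▸ Fintype.one_lt_card
  have : IsUltrametricDist L :=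
    IsUltrametricDist.isUltrametricDist_of_forall_norm_add_le_max_norm hna
  obtain ⟨p, hp⟩ := CharP.exists Fq
  have : Fact p.Prime := ⟨CharP.char_is_prime Fq p⟩
  have : CharP L p := charP_of_injective_ringHom
    ((algebraMap (Polynomial Fq) L).comp Polynomial.C).injective p
  have hs : IsSign sgn := isSign_of_uPart p hq1 hval hρ hsgn
  have hlog : ∀ z : L, z ≠ 0 → ∃ d : ℚ, logq q z = d := by
    intro z hz
    obtain ⟨d, hd⟩ := hval z hz
    refine ⟨d, ?_⟩
    rw [logq, hd, Real.logb_rpow (by positivity) (by exact_mod_cast hq1.ne')]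
  have hu0 : u ≠ 0 := fun h => huΛ (h ▸ Λ.zero_mem)
  obtain ⟨N₀, hN₀⟩ := hlog u hu0
  have hmain := fun (N : ℚ) (hN : N₀ ≤ N) => sgnProd_eq_mul hq1 hs hΛ.2 huΛ hN₀.le hN
  refine ⟨N₀, _, ?_, hmain, fun u' hu' => ⟨N₀, fun N hN => ?_⟩, fun a b ha hb => ?_⟩
  · rw [← isOfFinOrder_iff_pow_eq_one]
    refine (hs.isOfFinOrder u hu0).mul ?_
    refine finprod_mem_induction IsOfFinOrder IsOfFinOrder.one (fun _ _ => IsOfFinOrder.mul)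
      fun l hl => (hs.isOfFinOrder _ fun h => huΛ ?_).mul
        (hs.isOfFinOrder l hl.1).inv_of_field
    rw [eq_neg_of_add_eq_zero_right h]
    exact Λ.neg_mem (by simpa using hl.2.1)
  · rw [sgnProd, ballSet_congr q hu', ← sgnProd, hmain N hN]
  · have hne : ∀ x : Polynomial Fq, x ≠ 0 → algebraMap (Polynomial Fq) L x ≠ 0 := by
      intro x hx
      rw [← norm_pos_iff, hA x hx]
      positivity
    have hc := div_ne_zero (hne a ha) (hne b hb)
    set c := algebraMap (Polynomial Fq) L a / algebraMap (Polynomial Fq) L b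
    obtain ⟨d, hd⟩ := hlog c hc
    refine ⟨N₀ + d, fun N hN => ?_⟩
    have hNd : N₀ ≤ N - d := le_sub_iff_add_le.2 hN
    have hNu : logq q u ≤ ((N - d : ℚ) : ℝ) := hN₀.le.trans (by exact_mod_cast hNd)
    have hcard := ncard_ballSet hq1 hΛ.2 huΛ hNu
    have hfin₀ := ballSet_zero_finite hq1 hΛ.2 (N - d)
    have hfin : (ballSet q Λ u (N - d)).Finite := by
      rw [ballSet_eq_insert hq1 huΛ hNu]
      exact (hfin₀.image _).insert u
    have h0 := sgnProd_scaleSub hs hc hd N hfin₀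
    rw [mul_zero] at h0
    rw [h0, sgnProd_scaleSub hs hc hd N hfin, hcard, hmain _ hNd, pow_succ]
    ring
end
end
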